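/- Every Lie algebra automorphism of 𝔠𝔥(n) has matrix in the ordered basis of the block form F = [[1, 0, 0],[u, M, 0],[a, vᵀ, λ]] (blocks of sizes 1, 2n−2, 1), where M ∈ GL(2n−2, ℝ) satisfies MᵀJ_{n−1}M = λJ_{n−1} for some λ ≠ 0, a ∈ ℝ, v ∈ ℝ^{2n−2}, and u = (1/(2λ)) M J_{n−1} v. -/

import Mathlib

noncomputable section

open Matrix BigOperators Finset

namespace CHn

/-- Structure constants of the Lie algebra 𝔠𝔥(n) in the ordered basis
`(X, Y_1, …, Y_{n-1}, Z_1, …, Z_{n-1}, W)`: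
index `0 ↦ X`, indices `1,…,n-1 ↦ Y_1,…,Y_{n-1}`,
indices `n,…,2n-2 ↦ Z_1,…,Z_{n-1}`, index `2n-1 ↦ W`.
The nonzero brackets are `[X,Y_i] = (1/2)Y_i`, `[X,Z_i] = (1/2)Z_i`,
`[X,W] = W`, `[Z_j,Y_i] = δ_{ij} W`. -/
def structC (n : ℕ) (i j k : Fin (2 * n)) : ℝ :=
  (if i.val = 0 ∧ j = k ∧ 1 ≤ j.val ∧ j.val ≤ 2 * n - 2 then (1 : ℝ) / 2 else 0)
  - (if j.val = 0 ∧ i = k ∧ 1 ≤ i.val ∧ i.val ≤ 2 * n - 2 then (1 : ℝ) / 2 else 0)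
  + (if i.val = 0 ∧ j.val = 2 * n - 1 ∧ k.val = 2 * n - 1 then (1 : ℝ) else 0)
  - (if j.val = 0 ∧ i.val = 2 * n - 1 ∧ k.val = 2 * n - 1 then (1 : ℝ) else 0)
  + (if n ≤ i.val ∧ i.val ≤ 2 * n - 2 ∧ i.val = j.val + (n - 1) ∧ k.val = 2 * n - 1
      then (1 : ℝ) else 0)
  - (if n ≤ j.val ∧ j.val ≤ 2 * n - 2 ∧ j.val = i.val + (n - 1) ∧ k.val = 2 * n - 1
      then (1 : ℝ) else 0)

/-- The Lie bracket of `𝔠𝔥(n)`, as a bilinear operation on coordinate vectors. -/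
def bracket (n : ℕ) (u v : Fin (2 * n) → ℝ) : Fin (2 * n) → ℝ :=
  fun k => ∑ i, ∑ j, u i * v j * structC n i j k

/-- `F` is the matrix (in the ordered basis) of a Lie algebra automorphism of `𝔠𝔥(n)`. -/
def IsAut (n : ℕ) (F : Matrix (Fin (2 * n)) (Fin (2 * n)) ℝ) : Prop :=
  IsUnit F ∧ ∀ u v, F.mulVec (bracket n u v) = bracket n (F.mulVec u) (F.mulVec v)

/-- The normal form `S(p, x, σ, β)`: the block matrix
`[[p, xᵀ, 0, 0], [x, σ, 0, 0], [0, 0, σ, 0], [0, 0, 0, β]]`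
with blocks of sizes `1, n-1, n-1, 1`. -/
def Sform (n : ℕ) (p : ℝ) (x σ : Fin (n - 1) → ℝ) (β : ℝ) :
    Matrix (Fin (2 * n)) (Fin (2 * n)) ℝ := fun i j =>
  if i.val = 0 ∧ j.val = 0 then p
  else if h : i.val = 0 ∧ 1 ≤ j.val ∧ j.val ≤ n - 1 then x ⟨j.val - 1, by omega⟩
  else if h : j.val = 0 ∧ 1 ≤ i.val ∧ i.val ≤ n - 1 then x ⟨i.val - 1, by omega⟩
  else if h : i = j ∧ 1 ≤ i.val ∧ i.val ≤ n - 1 then σ ⟨i.val - 1, by omega⟩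
  else if h : i = j ∧ n ≤ i.val ∧ i.val ≤ 2 * n - 2 then σ ⟨i.val - n, by omega⟩
  else if i = j ∧ i.val = 2 * n - 1 then β
  else 0

/-- Admissibility of the parameters `(p, x, σ, β)`:
`p, β > 0`, all `x_i ≥ 0`, `σ_1 ≥ … ≥ σ_{n-2} ≥ 1` and the convention `σ_{n-1} = 1`. -/
def Admissible (n : ℕ) (p : ℝ) (x σ : Fin (n - 1) → ℝ) (β : ℝ) : Prop :=
  0 < p ∧ 0 < β ∧ (∀ i, 0 ≤ x i) ∧ Antitone σ ∧ (∀ i, 1 ≤ σ i) ∧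
    ∀ _h : 1 ≤ n - 1, σ ⟨n - 2, by omega⟩ = 1

/-- `z = p - Σ_i x_i² / σ_i`. -/
def zval (n : ℕ) (p : ℝ) (x σ : Fin (n - 1) → ℝ) : ℝ :=
  p - ∑ i, (x i) ^ 2 / σ i

/-- The inner product on `𝔠𝔥(n)` determined by a matrix `S`. -/
def ip (n : ℕ) (S : Matrix (Fin (2 * n)) (Fin (2 * n)) ℝ) (u v : Fin (2 * n) → ℝ) : ℝ :=
  u ⬝ᵥ S.mulVec v

/-- The coordinates (w.r.t. the standard basis) of the Koszul form
`K(u,v)(T) = ⟨[u,v],T⟩ - ⟨[v,T],u⟩ + ⟨[T,u],v⟩`. -/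
def koszul (n : ℕ) (S : Matrix (Fin (2 * n)) (Fin (2 * n)) ℝ)
    (u v : Fin (2 * n) → ℝ) : Fin (2 * n) → ℝ := fun t =>
  ip n S (bracket n u v) (Pi.single t 1) - ip n S (bracket n v (Pi.single t 1)) u
    + ip n S (bracket n (Pi.single t 1) u) v

/-- The Levi-Civita product `∇_u v` of the inner product `S`,
i.e. the unique solution of the Koszul formula `2⟨∇_u v, T⟩ = K(u,v)(T)`
(for invertible symmetric `S`). -/
def nabla (n : ℕ) (S : Matrix (Fin (2 * n)) (Fin (2 * n)) ℝ)
    (u v : Fin (2 * n) → ℝ) : Fin (2 * n) → ℝ :=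
  (2 : ℝ)⁻¹ • (S⁻¹).mulVec (koszul n S u v)

/-- The curvature operator `R(u,v)w = ∇_u∇_v w - ∇_v∇_u w - ∇_{[u,v]} w`. -/
def curv (n : ℕ) (S : Matrix (Fin (2 * n)) (Fin (2 * n)) ℝ)
    (u v w : Fin (2 * n) → ℝ) : Fin (2 * n) → ℝ :=
  nabla n S u (nabla n S v w) - nabla n S v (nabla n S u w) - nabla n S (bracket n u v) w

/-- The Ricci form `Ric(u,v) = tr (T ↦ R(T,u)v)`. -/
def ricci (n : ℕ) (S : Matrix (Fin (2 * n)) (Fin (2 * n)) ℝ)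
    (u v : Fin (2 * n) → ℝ) : ℝ :=
  ∑ t, curv n S (Pi.single t 1) u v t

/-- The scalar curvature `τ = Σ_{i,j} g^{ij} Ric(e_i, e_j)`. -/
def scalarCurv (n : ℕ) (S : Matrix (Fin (2 * n)) (Fin (2 * n)) ℝ) : ℝ :=
  ∑ i, ∑ j, (S⁻¹) i j * ricci n S (Pi.single i 1) (Pi.single j 1)

/-- The wedge endomorphism `(u∧v)(w) = ⟨v,w⟩u - ⟨u,w⟩v`. -/
def wedge (n : ℕ) (S : Matrix (Fin (2 * n)) (Fin (2 * n)) ℝ)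
    (u v : Fin (2 * n) → ℝ) : (Fin (2 * n) → ℝ) → (Fin (2 * n) → ℝ) :=
  fun w => ip n S v w • u - ip n S u w • v

/-- The standard symplectic matrix `J_m = [[0, I_m], [-I_m, 0]]`. -/
def Jmat (m : ℕ) : Matrix (Fin (2 * m)) (Fin (2 * m)) ℝ := fun i j =>
  if j.val = i.val + m then 1 else if i.val = j.val + m then -1 else 0

/-- The block matrix `[[1, 0, 0], [u, M, 0], [a, vᵀ, λ]]`
with blocks of sizes `1, 2n-2, 1`. -/
def blockF (n : ℕ) (M : Matrix (Fin (2 * (n - 1))) (Fin (2 * (n - 1))) ℝ)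
    (u v : Fin (2 * (n - 1)) → ℝ) (a lam : ℝ) :
    Matrix (Fin (2 * n)) (Fin (2 * n)) ℝ := fun i j =>
  if i.val = 0 then (if j.val = 0 then 1 else 0)
  else if h : 1 ≤ i.val ∧ i.val ≤ 2 * n - 2 then
    (if j.val = 0 then u ⟨i.val - 1, by omega⟩
     else if h2 : 1 ≤ j.val ∧ j.val ≤ 2 * n - 2 then
       M ⟨i.val - 1, by omega⟩ ⟨j.val - 1, by omega⟩
     else 0)
  else
    (if j.val = 0 then a
     else if h2 : 1 ≤ j.val ∧ j.val ≤ 2 * n - 2 then v ⟨j.val - 1, by omega⟩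
     else lam)

/-- The metric is Einstein: the Ricci form is proportional to the inner product. -/
def IsEinstein (n : ℕ) (S : Matrix (Fin (2 * n)) (Fin (2 * n)) ℝ) : Prop :=
  ∃ c : ℝ, ∀ u v, ricci n S u v = c * ip n S u v

end CHn

namespace CHn

/-- Index of `X`. -/
def ix (n : ℕ) (hn : 2 ≤ n) : Fin (2 * n) := ⟨0, by omega⟩
/-- Index of `W`. -/
def iw (n : ℕ) (hn : 2 ≤ n) : Fin (2 * n) := ⟨2 * n - 1, by omega⟩
/-- Indices of the `Y_i`, `Z_i`. -/
def im (n : ℕ) (hn : 2 ≤ n) (i : Fin (2 * (n - 1))) : Fin (2 * n) := ⟨i.val + 1, by omega⟩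

lemma sum_split (n : ℕ) (hn : 2 ≤ n) (f : Fin (2 * n) → ℝ) :
    ∑ i, f i = f (ix n hn) + ∑ i, f (im n hn i) + f (iw n hn) := by
  have e : 2 * n = (2 * (n - 1) + 1) + 1 := by omega
  rw [← (finCongr e).symm.sum_comp, Fin.sum_univ_castSucc, Fin.sum_univ_succ]
  congr 1
  congr 1
  simp only [iw]
  congr 1
  ext
  simp
  omega

lemma idx_cases (n : ℕ) (hn : 2 ≤ n) (i : Fin (2 * n)) :
    i = ix n hn ∨ i = iw n hn ∨ ∃ j, i = im n hn j := by
  by_cases h0 : i.val = 0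
  · left; exact Fin.ext h0
  by_cases h1 : i.val = 2 * n - 1
  · right; left; exact Fin.ext h1
  right; right
  refine ⟨⟨i.val - 1, by omega⟩, ?_⟩
  apply Fin.ext
  simp only [im]
  omega

section
variable (n : ℕ) (hn : 2 ≤ n)

lemma c_x (i j : Fin (2 * n)) : structC n i j (ix n hn) = 0 := by
  unfold structC ix
  simp only [Fin.ext_iff]
  repeat rw [if_neg (by omega)]
  norm_num

lemma c_m (i j : Fin (2 * n)) (k : Fin (2 * (n - 1))) : structC n i j (im n hn k) =
    (if i = ix n hn then if j = im n hn k then 1 / 2 else 0 else 0)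
     - (if j = ix n hn then if i = im n hn k then 1 / 2 else 0 else 0) := by
  have := k.2
  unfold structC ix im
  simp only [Fin.ext_iff, and_true, true_and, false_and]
  split_ifs <;> first | omega | contradiction | norm_num

lemma cw_xx : structC n (ix n hn) (ix n hn) (iw n hn) = 0 := by
  unfold structC ix iw
  simp only [Fin.ext_iff, and_true, true_and, false_and]
  split_ifs <;> first | omega | contradiction | norm_num
lemma cw_ww : structC n (iw n hn) (iw n hn) (iw n hn) = 0 := by
  unfold structC iw
  simp only [Fin.ext_iff, and_true, true_and, false_and]
  split_ifs <;> first | omega | contradiction | norm_num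
lemma cw_xw : structC n (ix n hn) (iw n hn) (iw n hn) = 1 := by
  unfold structC ix iw
  simp only [Fin.ext_iff, and_true, true_and, false_and]
  split_ifs <;> first | omega | contradiction | norm_num
lemma cw_wx : structC n (iw n hn) (ix n hn) (iw n hn) = -1 := by
  unfold structC ix iw
  simp only [Fin.ext_iff, and_true, true_and, false_and]
  split_ifs <;> first | omega | contradiction | norm_num
lemma cw_xm (i) : structC n (ix n hn) (im n hn i) (iw n hn) = 0 := by
  have := i.2
  unfold structC ix iw im
  simp only [Fin.ext_iff, and_true, true_and, false_and]
  split_ifs <;> first | omega | contradiction | norm_num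
lemma cw_mx (i) : structC n (im n hn i) (ix n hn) (iw n hn) = 0 := by
  have := i.2
  unfold structC ix iw im
  simp only [Fin.ext_iff, and_true, true_and, false_and]
  split_ifs <;> first | omega | contradiction | norm_num
lemma cw_wm (i) : structC n (iw n hn) (im n hn i) (iw n hn) = 0 := by
  have := i.2
  unfold structC iw im
  simp only [Fin.ext_iff, and_true, true_and, false_and]
  split_ifs <;> first | omega | contradiction | norm_num
lemma cw_mw (i) : structC n (im n hn i) (iw n hn) (iw n hn) = 0 := by
  have := i.2
  unfold structC iw im
  simp only [Fin.ext_iff, and_true, true_and, false_and]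
  split_ifs <;> first | omega | contradiction | norm_num
lemma cw_mm (i j) : structC n (im n hn i) (im n hn j) (iw n hn) = - Jmat (n - 1) i j := by
  have := i.2
  have := j.2
  unfold structC iw im Jmat
  simp only [Fin.ext_iff, and_true, true_and, false_and]
  split_ifs <;> first | omega | contradiction | norm_num

lemma b_x (u v) : bracket n u v (ix n hn) = 0 := by
  simp [bracket, c_x]

lemma b_m (u v) (k) : bracket n u v (im n hn k) =
    (u (ix n hn) * v (im n hn k) - v (ix n hn) * u (im n hn k)) / 2 := by
  simp only [bracket, c_m, mul_sub, sum_sub_distrib, mul_ite, mul_zero]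
  simp
  ring

lemma b_w (u v) : bracket n u v (iw n hn) =
    u (ix n hn) * v (iw n hn) - v (ix n hn) * u (iw n hn)
     - ∑ i, ∑ j, u (im n hn i) * v (im n hn j) * Jmat (n - 1) i j := by
  simp only [bracket, sum_split n hn, cw_xx, cw_ww, cw_xw, cw_wx, cw_xm, cw_mx, cw_wm, cw_mw,
    cw_mm]
  simp
  ring

lemma J_sq (m : ℕ) : Jmat m * Jmat m = -1 := by
  ext i j
  have hi := i.2
  have hj := j.2
  rw [mul_apply, neg_apply, one_apply]
  by_cases h : i.val < m
  · rw [Finset.sum_eq_single ⟨i.val + m, by omega⟩]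
    · simp only [Jmat, Fin.ext_iff]
      split_ifs <;> first | omega | contradiction | norm_num
    · intro b _ hb
      simp only [Jmat, ne_eq, Fin.ext_iff] at *
      split_ifs <;> first | omega | contradiction | norm_num
    · simp
  · rw [Finset.sum_eq_single ⟨i.val - m, by omega⟩]
    · simp only [Jmat, Fin.ext_iff]
      split_ifs <;> first | omega | contradiction | norm_num
    · intro b _ hb
      have := b.2
      simp only [Jmat, ne_eq, Fin.ext_iff] at *
      split_ifs <;> first | omega | contradiction | norm_num
    · simp

lemma J_tr (m : ℕ) : (Jmat m)ᵀ = - Jmat m := by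
  ext i j
  rw [transpose_apply, Matrix.neg_apply]
  have hi := i.2
  have hj := j.2
  simp only [Jmat]
  split_ifs <;> first | omega | contradiction | norm_num

lemma mid_ne_x (i) : im n hn i ≠ ix n hn := by simp [im, ix]
lemma mid_ne_w (i) : im n hn i ≠ iw n hn := by simp [im, iw]; omega
lemma x_ne_w : ix n hn ≠ iw n hn := by simp [ix, iw]; omega
lemma mid_inj (i j) : im n hn i = im n hn j ↔ i = j := by simp [im, Fin.ext_iff]

lemma vec_ext {u v : Fin (2 * n) → ℝ} (hx : u (ix n hn) = v (ix n hn))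
    (hm : ∀ i, u (im n hn i) = v (im n hn i)) (hw : u (iw n hn) = v (iw n hn)) : u = v := by
  ext i
  rcases idx_cases n hn i with rfl | rfl | ⟨j, rfl⟩
  exacts [hx, hw, hm j]

lemma br_xm (i) : bracket n (Pi.single (ix n hn) 1) (Pi.single (im n hn i) 1)
    = (1 / 2 : ℝ) • Pi.single (im n hn i) 1 := by
  apply vec_ext n hn
  · simp [b_x, Pi.single_apply, (mid_ne_x n hn _).symm]
  · intro k
    simp [b_m, Pi.single_apply, (mid_ne_x n hn _).symm, mid_ne_x]
    split_ifs <;> norm_num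
  · simp [b_w, Pi.single_apply, (mid_ne_x n hn _).symm, mid_ne_x, (mid_ne_w n hn _).symm,
      (x_ne_w n hn).symm]

lemma br_xw : bracket n (Pi.single (ix n hn) 1) (Pi.single (iw n hn) 1)
    = Pi.single (iw n hn) 1 := by
  apply vec_ext n hn
  · simp [b_x, Pi.single_apply, x_ne_w]
  · intro k
    simp [b_m, Pi.single_apply, mid_ne_x, mid_ne_w]
  · simp [b_w, Pi.single_apply, mid_ne_x, mid_ne_w, (x_ne_w n hn).symm]

lemma br_mm (i j) : bracket n (Pi.single (im n hn i) 1) (Pi.single (im n hn j) 1)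
    = (- Jmat (n - 1) i j) • Pi.single (iw n hn) 1 := by
  apply vec_ext n hn
  · simp [b_x, Pi.single_apply, x_ne_w]
  · intro k
    simp [b_m, Pi.single_apply, mid_ne_w, (mid_ne_x n hn _).symm]
  · simp [b_w, Pi.single_apply, (mid_ne_x n hn _).symm, (mid_ne_w n hn _).symm, mid_inj]

end

/-- Every Lie algebra automorphism of `𝔠𝔥(n)` has matrix of the block form
`[[1,0,0],[u,M,0],[a,vᵀ,λ]]` with `M` invertible, `MᵀJ_{n-1}M = λJ_{n-1}`,
`λ ≠ 0` and `u = (1/(2λ)) M J_{n-1} v`. -/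
theorem aut_eq_blockF (n : ℕ) (hn : 2 ≤ n)
    (F : Matrix (Fin (2 * n)) (Fin (2 * n)) ℝ) (hF : IsAut n F) :
    ∃ (M : Matrix (Fin (2 * (n - 1))) (Fin (2 * (n - 1))) ℝ)
      (v : Fin (2 * (n - 1)) → ℝ) (a lam : ℝ),
      IsUnit M ∧ lam ≠ 0 ∧
      M.transpose * Jmat (n - 1) * M = lam • Jmat (n - 1) ∧
      F = blockF n M ((1 / (2 * lam)) • M.mulVec ((Jmat (n - 1)).mulVec v)) v a lam := by
  obtain ⟨hU, hB⟩ := hF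
  have col : ∀ i k, F.mulVec (Pi.single i 1) k = F k i := by intro i k; simp
  -- component form of the three bracket relations
  have Hxm : ∀ i k, 1 / 2 * F k (im n hn i)
      = bracket n (F.mulVec (Pi.single (ix n hn) 1)) (F.mulVec (Pi.single (im n hn i) 1)) k := by
    intro i k
    rw [← hB, br_xm, mulVec_smul, Pi.smul_apply, col, smul_eq_mul]
  have Hxw : ∀ k, F k (iw n hn)
      = bracket n (F.mulVec (Pi.single (ix n hn) 1)) (F.mulVec (Pi.single (iw n hn) 1)) k := by
    intro k
    rw [← hB, br_xw, col]
  have Hmm : ∀ i j k, - Jmat (n - 1) i j * F k (iw n hn)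
      = bracket n (F.mulVec (Pi.single (im n hn i) 1)) (F.mulVec (Pi.single (im n hn j) 1)) k := by
    intro i j k
    rw [← hB, br_mm, mulVec_smul, Pi.smul_apply, col, smul_eq_mul]
  have F0m : ∀ i, F (ix n hn) (im n hn i) = 0 := by
    intro i
    have := Hxm i (ix n hn)
    rw [b_x] at this
    linarith
  have F0w : F (ix n hn) (iw n hn) = 0 := by rw [Hxw, b_x]
  have Fmw : ∀ k, F (im n hn k) (iw n hn) = 0 := by
    intro k
    have := Hmm ⟨0, by omega⟩ ⟨n - 1, by omega⟩ (im n hn k)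
    rw [b_m] at this
    simp only [col, F0m, Jmat] at this
    simpa using this
  have hlam : F (iw n hn) (iw n hn) ≠ 0 := by
    intro h
    have hz : F.mulVec (Pi.single (iw n hn) 1) = F.mulVec 0 := by
      rw [mulVec_zero]
      apply vec_ext n hn
      · rw [col, F0w]; rfl
      · intro i; rw [col, Fmw]; rfl
      · rw [col, h]; rfl
    have := congrFun (Matrix.mulVec_injective_of_isUnit hU hz) (iw n hn)
    simp at this
  have F00 : F (ix n hn) (ix n hn) = 1 := by
    have := Hxw (iw n hn)
    rw [b_w] at this
    simp only [col, F0w, Fmw] at this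
    simp only [zero_mul, mul_zero, sum_const_zero, sub_zero] at this
    exact mul_right_cancel₀ hlam (by rw [one_mul]; exact this.symm)
  set lam := F (iw n hn) (iw n hn) with hl
  let M : Matrix (Fin (2 * (n - 1))) (Fin (2 * (n - 1))) ℝ :=
    fun i j => F (im n hn i) (im n hn j)
  let v : Fin (2 * (n - 1)) → ℝ := fun j => F (iw n hn) (im n hn j)
  let u : Fin (2 * (n - 1)) → ℝ := fun j => F (im n hn j) (ix n hn)
  have hMJ : M.transpose * Jmat (n - 1) * M = lam • Jmat (n - 1) := by
    ext i j
    have := Hmm i j (iw n hn)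
    rw [b_w] at this
    simp only [col, F0m] at this
    simp only [mul_apply, transpose_apply, Matrix.smul_apply, smul_eq_mul, sum_mul]
    rw [sum_comm]
    have e : ∑ x, ∑ y, M x i * Jmat (n - 1) x y * M y j
      = ∑ x, ∑ y, F (im n hn x) (im n hn i) * F (im n hn y) (im n hn j) * Jmat (n - 1) x y := by
      refine sum_congr rfl fun x _ => sum_congr rfl fun y _ => ?_
      simp only [M]; ring
    rw [e]
    linarith
  have hv : v = (-2 : ℝ) • (M.transpose).mulVec ((Jmat (n - 1)).mulVec u) := by
    ext j
    have := Hxm j (iw n hn)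
    rw [b_w] at this
    simp only [col, F0m, F00] at this
    simp only [Pi.smul_apply, smul_eq_mul, mulVec, dotProduct, transpose_apply, mul_sum]
    have e : ∑ x, ∑ y, F (im n hn x) (ix n hn) * F (im n hn y) (im n hn j) * Jmat (n - 1) x y
      = - ∑ x, ∑ y, M x j * (Jmat (n - 1) x y * u y) := by
      rw [sum_comm, ← sum_neg_distrib]
      refine sum_congr rfl fun x _ => ?_
      rw [← sum_neg_distrib]
      refine sum_congr rfl fun y _ => ?_
      have := congrFun (congrFun (J_tr (n - 1)) x) y
      rw [transpose_apply, Matrix.neg_apply] at this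
      simp only [M, u, this]; ring
    rw [e] at this
    simp only [← mul_sum] at this ⊢
    simp only [v]
    linarith
  have hinv : (-lam⁻¹) • (Jmat (n - 1) * (M.transpose * Jmat (n - 1))) * M = 1 := by
    rw [smul_mul_assoc, Matrix.mul_assoc, hMJ, mul_smul_comm, J_sq, smul_smul]
    simp [hlam]
  have hinv' := mul_eq_one_comm.mp hinv
  have hMu : IsUnit M := IsUnit.of_mul_eq_one _ hinv'
  have hu : u = (1 / (2 * lam)) • M.mulVec ((Jmat (n - 1)).mulVec v) := by
    have h1 : u = (M * (-lam⁻¹) • (Jmat (n - 1) * (M.transpose * Jmat (n - 1)))).mulVec u := by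
      rw [hinv', one_mulVec]
    rw [hv, mulVec_smul, mulVec_smul, smul_smul]
    conv_lhs => rw [h1]
    rw [mul_smul_comm, smul_mulVec]
    simp only [mulVec_mulVec, Matrix.mul_assoc]
    congr 1
    field_simp
  refine ⟨M, v, F (iw n hn) (ix n hn), lam, hMu, hlam, hMJ, ?_⟩
  rw [← hu]
  have key : ∀ i j, im n hn j = i → ∀ h, (⟨i.val - 1, h⟩ : Fin (2 * (n - 1))) = j := by
    rintro _ j rfl h
    simp [im]
  ext i j
  rcases idx_cases n hn i with rfl | rfl | ⟨i, rfl⟩ <;>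
  rcases idx_cases n hn j with rfl | rfl | ⟨j, rfl⟩
  · simp [blockF, F00, ix]; exact F00
  · have h1 : ¬ (2 * n - 1 = 0) := by omega
    rw [F0w]; simp [blockF, ix, iw, h1]
  · rw [F0m]; simp [blockF, ix, im]
  · have h1 : ¬ (2 * n - 1 = 0) := by omega
    have h2 : ¬ (2 * n - 1 ≤ 2 * n - 2) := by omega
    simp [blockF, ix, iw, h1, h2]
  · have h1 : ¬ (2 * n - 1 = 0) := by omega
    have h2 : ¬ (2 * n - 1 ≤ 2 * n - 2) := by omega
    simp [blockF, iw, h1, h2, hl]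
  · have h1 : ¬ (2 * n - 1 = 0) := by omega
    have h2 : ¬ (2 * n - 1 ≤ 2 * n - 2) := by omega
    have h3 : j.val + 1 ≤ 2 * n - 2 := by omega
    simp [blockF, im, iw, h1, h2, h3, v]
  · have h3 : i.val + 1 ≤ 2 * n - 2 := by omega
    simp [blockF, im, ix, h3, u]
  · rw [Fmw]
    have h1 : ¬ (2 * n - 1 = 0) := by omega
    have h2 : ¬ (2 * n - 1 ≤ 2 * n - 2) := by omega
    have h3 : i.val + 1 ≤ 2 * n - 2 := by omega
    simp [blockF, im, iw, h1, h2, h3]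
  · have h3 : i.val + 1 ≤ 2 * n - 2 := by omega
    have h4 : j.val + 1 ≤ 2 * n - 2 := by omega
    simp [blockF, im, h3, h4, M]

end CHn
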